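/- arXiv:math/0208243 — 2 statements merged into one kernel-verified Lean document; each statement's English description precedes it below -/
import Mathlib

section
/- Let d ≥ 1, let E := EuclideanSpace ℝ (Fin d), and let X ⊆ E be an (r,R)-Delone set. Then for every y ∈ X the set X ∩ Metric.closedBall y (2*R) is finite, and the closed Voronoi cell of y is cut out by the finitely many bisector half-spaces of these nearby points: closure V_y = ⋂_{x ∈ X ∩ Metric.closedBall y (2*R)} {z ∈ E | dist z y ≤ dist z x}. In particular, closure V_y is a compact convex set equal to a finite intersection of closed half-spaces (a convex polytope). -/
noncomputable section

/-- The Euclidean space `ℝ^d`. -/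
abbrev Ee (d : ℕ) := EuclideanSpace ℝ (Fin d)

/-- `X` is an `(r, R)`-Delone set in `ℝ^d`: every open ball of radius `r` contains at most
one point of `X`, and every open ball of radius `R` contains at least one point of `X`. -/
def IsDelone {d : ℕ} (r R : ℝ) (X : Set (Ee d)) : Prop :=
  (∀ z : Ee d, (X ∩ Metric.ball z r).Subsingleton) ∧
    (∀ z : Ee d, (X ∩ Metric.ball z R).Nonempty)

/-- The (open) Voronoi cell of a point `y` of a Delone set `X`: the points strictly closer
to `y` than to any other point of `X`. -/
def voronoiCell {d : ℕ} (X : Set (Ee d)) (y : Ee d) : Set (Ee d) :=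
  {z : Ee d | ∀ x ∈ X, x ≠ y → dist z y < dist z x}

lemma isClosed_setOf_dist_le_dist {F : Type*} [PseudoMetricSpace F] (x y : F) :
    IsClosed {z : F | dist z y ≤ dist z x} :=
  isClosed_le (by fun_prop) (by fun_prop)

section InnerProduct

variable {F : Type*} [NormedAddCommGroup F] [InnerProductSpace ℝ F]

lemma dist_sq_eq_dist_sq_sub_inner (x y z : F) :
    dist z x ^ 2 = dist z y ^ 2 - 2 * inner ℝ (x - y) (z - y) + ‖x - y‖ ^ 2 := by
  rw [dist_eq_norm, dist_eq_norm, ← sub_sub_sub_cancel_right z x y, norm_sub_sq_real,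
    real_inner_comm]

lemma dist_le_dist_iff_inner_le (x y z : F) :
    dist z y ≤ dist z x ↔ 2 * inner ℝ (x - y) (z - y) ≤ ‖x - y‖ ^ 2 := by
  rw [← sq_le_sq₀ dist_nonneg dist_nonneg, dist_sq_eq_dist_sq_sub_inner x y z]
  constructor <;> intro h <;> linarith

lemma dist_lt_dist_iff_inner_lt (x y z : F) :
    dist z y < dist z x ↔ 2 * inner ℝ (x - y) (z - y) < ‖x - y‖ ^ 2 := by
  rw [← sq_lt_sq₀ dist_nonneg dist_nonneg, dist_sq_eq_dist_sq_sub_inner x y z]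
  constructor <;> intro h <;> linarith

lemma convex_setOf_dist_le_dist (x y : F) : Convex ℝ {z : F | dist z y ≤ dist z x} := by
  intro u hu v hv a b ha hb hab
  simp only [Set.mem_ofPred_eq, dist_le_dist_iff_inner_le] at hu hv ⊢
  have h : a • u + b • v - y = a • (u - y) + b • (v - y) := by
    rw [smul_sub, smul_sub, sub_add_sub_comm, ← add_smul, hab, one_smul]
  rw [h, inner_add_right, real_inner_smul_right, real_inner_smul_right]
  calc _ = a * (2 * inner ℝ (x - y) (u - y)) + b * (2 * inner ℝ (x - y) (v - y)) := by ring
    _ ≤ a * ‖x - y‖ ^ 2 + b * ‖x - y‖ ^ 2 := by gcongr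
    _ = ‖x - y‖ ^ 2 := by rw [← add_mul, hab, one_mul]

/-- Points strictly between `y` and a point weakly closer to `y` than to `x` are strictly closer
to `y`. -/
lemma dist_lt_dist_of_mem_openSegment {x y z w : F} (hxy : x ≠ y) (hz : dist z y ≤ dist z x)
    (hw : w ∈ openSegment ℝ y z) : dist w y < dist w x := by
  obtain ⟨a, b, ha, hb, hab, rfl⟩ := hw
  rw [dist_le_dist_iff_inner_le] at hz
  rw [dist_lt_dist_iff_inner_lt]
  have h : a • y + b • z - y = b • (z - y) := by
    rw [← eq_sub_iff_add_eq] at hab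
    subst hab
    module
  have hpos : 0 < ‖x - y‖ ^ 2 := pow_pos (norm_pos_iff.2 (sub_ne_zero.2 hxy)) 2
  rw [h, real_inner_smul_right]
  nlinarith

end InnerProduct

lemma IsDelone.finite_inter_closedBall {d : ℕ} {r R : ℝ} {X : Set (Ee d)} (hX : IsDelone r R X)
    (hr : 0 < r) (y : Ee d) (ρ : ℝ) : (X ∩ Metric.closedBall y ρ).Finite := by
  obtain ⟨t, ht, hcover⟩ :=
    Metric.totallyBounded_iff.1 (isCompact_closedBall y ρ).totallyBounded r hr
  refine (ht.biUnion fun z _ => (hX.1 z).finite).subset fun x hx => ?_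
  obtain ⟨z, hz, hxz⟩ := Set.mem_iUnion₂.1 (hcover hx.2)
  exact Set.mem_iUnion₂.2 ⟨z, hz, hx.1, hxz⟩

/-- The intersection of the bisector half-spaces of the points of `X` within distance `2 * R`
of `y` lies in the open ball of radius `R` around `y`. -/
lemma IsDelone.iInter_bisector_subset_ball {d : ℕ} {r R : ℝ} {X : Set (Ee d)}
    (hX : IsDelone r R X) (hR : 0 < R) (y : Ee d) :
    ⋂ x ∈ X ∩ Metric.closedBall y (2 * R), {z : Ee d | dist z y ≤ dist z x} ⊆
      Metric.ball y R := by
  intro z hz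
  rw [Set.mem_iInter₂] at hz
  rw [Metric.mem_ball]
  by_contra! hRz
  have hpos : 0 < dist z y := hR.trans_le hRz
  set w : Ee d := AffineMap.lineMap y z (R / dist z y) with hw
  have hwy : dist w y = R := by
    rw [hw, dist_lineMap_left, Real.norm_of_nonneg (by positivity), dist_comm y z,
      div_mul_cancel₀ _ hpos.ne']
  have hmem : w ∈ segment ℝ y z := by
    rw [segment_eq_image_lineMap]
    exact ⟨_, ⟨by positivity, (div_le_one hpos).2 hRz⟩, rfl⟩
  obtain ⟨x, hxX, hxw⟩ := hX.2 w
  rw [Metric.mem_ball'] at hxw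
  have hxy : dist x y ≤ 2 * R := by
    linarith [dist_triangle x w y, dist_comm x w]
  have := (convex_setOf_dist_le_dist x y).segment_subset (by simp) (hz x ⟨hxX, hxy⟩) hmem
  rw [Set.mem_ofPred_eq] at this
  linarith

lemma IsDelone.closure_voronoiCell {d : ℕ} {r R : ℝ} {X : Set (Ee d)}
    (hX : IsDelone r R X) (hR : 0 < R) (y : Ee d) :
    closure (voronoiCell X y) =
      ⋂ x ∈ X ∩ Metric.closedBall y (2 * R), {z : Ee d | dist z y ≤ dist z x} := by
  apply Set.Subset.antisymm
  · refine closure_minimal (fun z hz => Set.mem_iInter₂.2 fun x hx => ?_)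
      (isClosed_biInter fun x _ => isClosed_setOf_dist_le_dist x y)
    rcases eq_or_ne x y with rfl | hxy
    · exact le_refl (dist z x)
    · exact (hz x hx.1 hxy).le
  · intro z hz
    have hball := Metric.mem_ball.1 (hX.iInter_bisector_subset_ball hR y hz)
    have hle : ∀ x ∈ X, dist z y ≤ dist z x := by
      intro x hx
      by_cases hxy : dist x y ≤ 2 * R
      · exact Set.mem_iInter₂.1 hz x ⟨hx, hxy⟩
      · linarith [dist_triangle x z y, dist_comm x z]
    refine closure_mono (s := openSegment ℝ y z)
      (fun w hw x hx hxy => dist_lt_dist_of_mem_openSegment hxy (hle x hx) hw) ?_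
    rw [closure_openSegment]
    exact right_mem_segment ℝ y z

/-- For an `(r,R)`-Delone set `X` in `ℝ^d` and `y ∈ X`, the set
`X ∩ Metric.closedBall y (2*R)` is finite, and the closed Voronoi cell of `y` is cut out by
the finitely many bisector half-spaces of these nearby points.  In particular, the closed
Voronoi cell is a compact convex set equal to a finite intersection of closed half-spaces
(a convex polytope). -/
theorem closure_voronoiCell_polytope
    (d : ℕ) (hd : 1 ≤ d) (r R : ℝ) (hr : 0 < r) (hR : 0 < R)
    (X : Set (Ee d)) (hX : IsDelone r R X) (y : Ee d) (hy : y ∈ X) :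
    (X ∩ Metric.closedBall y (2 * R)).Finite ∧
      (closure (voronoiCell X y) =
        ⋂ x ∈ X ∩ Metric.closedBall y (2 * R), {z : Ee d | dist z y ≤ dist z x}) ∧
      IsCompact (closure (voronoiCell X y)) ∧ Convex ℝ (closure (voronoiCell X y)) := by
  have hclosure := hX.closure_voronoiCell hR y
  refine ⟨hX.finite_inter_closedBall hr y (2 * R), hclosure, ?_, ?_⟩
  · refine Metric.isCompact_of_isClosed_isBounded isClosed_closure
      (Metric.isBounded_ball.subset (?_ : _ ⊆ Metric.ball y R))
    rw [hclosure]
    exact hX.iInter_bisector_subset_ball hR y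
  · rw [hclosure]
    exact convex_iInter₂ fun x _ => convex_setOf_dist_le_dist x y
end
end

section
/- Let d ≥ 1, let E := EuclideanSpace ℝ (Fin d), and let X ⊆ E be an (r,R)-Delone set of finite local complexity which is repetitive and strongly aperiodic. Then the canonical transversal T, equipped with the patch topology, is nonempty and perfect, i.e., T has no isolated points. -/
noncomputable section

/-- The translate `S − x = {p − x | p ∈ S}` of a subset `S` of `ℝ^d`. -/
def setTranslate {d : ℕ} (S : Set (Ee d)) (x : Ee d) : Set (Ee d) :=
  (fun p => p - x) '' S

/-- `X` has finite local complexity (finite `ℝ^d`-type): for every `ρ > 0` there are only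
finitely many translated patches `(X − x) ∩ Metric.closedBall 0 ρ` with `x ∈ X`. -/
def HasFLC {d : ℕ} (X : Set (Ee d)) : Prop :=
  ∀ ρ : ℝ, 0 < ρ →
    {P : Set (Ee d) | ∃ x ∈ X, P = setTranslate X x ∩ Metric.closedBall 0 ρ}.Finite

/-- The local-isomorphism hull of `Z ⊆ ℝ^d`: the sets `Y` all of whose patches appear,
up to translation, as patches of `Z`. -/
def hull {d : ℕ} (Z : Set (Ee d)) : Set (Set (Ee d)) :=
  {Y : Set (Ee d) | ∀ z : Ee d, ∀ ρ : ℝ, 0 < ρ → ∃ w : Ee d,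
    setTranslate Y z ∩ Metric.closedBall 0 ρ = setTranslate Z w ∩ Metric.closedBall 0 ρ}

/-- The canonical transversal of `X`: the elements of the hull of `X` containing `0`. -/
def Transversal {d : ℕ} (X : Set (Ee d)) : Type :=
  {Y : Set (Ee d) // Y ∈ hull X ∧ (0 : Ee d) ∈ Y}

/-- The patch topology on the canonical transversal, generated by the sets
`U(ρ, P) = {Y | Y ∩ Metric.closedBall 0 ρ = P}` for `ρ > 0` and `P ⊆ ℝ^d`. -/
instance patchTopology {d : ℕ} (X : Set (Ee d)) : TopologicalSpace (Transversal X) :=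
  TopologicalSpace.generateFrom
    {U : Set (Transversal X) | ∃ ρ : ℝ, 0 < ρ ∧ ∃ P : Set (Ee d),
      U = {Y : Transversal X | Y.1 ∩ Metric.closedBall 0 ρ = P}}

/-- `X` is repetitive: for every `ρ > 0` there is `L > 0` such that every patch of radius
`ρ` of `X` reappears, up to translation, within distance `L` of every point of `ℝ^d`. -/
def IsRepetitive {d : ℕ} (X : Set (Ee d)) : Prop :=
  ∀ ρ : ℝ, 0 < ρ → ∃ L : ℝ, 0 < L ∧ ∀ x ∈ X, ∀ z : Ee d, ∃ y ∈ X,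
    dist y z ≤ L ∧
      setTranslate X y ∩ Metric.closedBall 0 ρ = setTranslate X x ∩ Metric.closedBall 0 ρ

/-- `X` is strongly aperiodic: no element of the hull of `X` has a nonzero translation
period. -/
def IsStronglyAperiodic {d : ℕ} (X : Set (Ee d)) : Prop :=
  ∀ Y ∈ hull X, ∀ v : Ee d, setTranslate Y v = Y → v = 0

theorem mem_setTranslate {d : ℕ} {S : Set (Ee d)} {x p : Ee d} :
    p ∈ setTranslate S x ↔ p + x ∈ S := by
  constructor
  · rintro ⟨q, hq, rfl⟩
    simpa using hq
  · intro h
    exact ⟨p + x, h, by simp⟩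

theorem setTranslate_setTranslate {d : ℕ} (S : Set (Ee d)) (x y : Ee d) :
    setTranslate (setTranslate S x) y = setTranslate S (y + x) := by
  ext p
  simp only [mem_setTranslate, add_assoc]

theorem setTranslate_zero {d : ℕ} (S : Set (Ee d)) : setTranslate S 0 = S := by
  ext p
  simp [mem_setTranslate]

theorem setTranslate_mem_hull {d : ℕ} (X : Set (Ee d)) (x : Ee d) :
    setTranslate X x ∈ hull X :=
  fun z _ _ => ⟨z + x, by rw [setTranslate_setTranslate]⟩

/-- The point `X − x` of the canonical transversal determined by a point `x` of `X`. -/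
def Transversal.ofMem {d : ℕ} {X : Set (Ee d)} {x : Ee d} (hx : x ∈ X) : Transversal X :=
  ⟨setTranslate X x, setTranslate_mem_hull X x, mem_setTranslate.2 (by simpa using hx)⟩

theorem IsStronglyAperiodic.setTranslate_injective {d : ℕ} {X : Set (Ee d)}
    (hap : IsStronglyAperiodic X) : Function.Injective (setTranslate X) := by
  intro x y hxy
  have hy := setTranslate_mem_hull X y
  refine sub_eq_zero.1 (hap _ hy (x - y) ?_)
  rw [setTranslate_setTranslate, sub_add_cancel, hxy]

theorem inter_closedBall_eq_of_le {d : ℕ} {S T : Set (Ee d)} {ρ σ : ℝ} (h : ρ ≤ σ)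
    (hST : S ∩ Metric.closedBall 0 σ = T ∩ Metric.closedBall 0 σ) :
    S ∩ Metric.closedBall 0 ρ = T ∩ Metric.closedBall 0 ρ := by
  have hsub : Metric.closedBall (0 : Ee d) ρ ⊆ Metric.closedBall 0 σ :=
    Metric.closedBall_subset_closedBall h
  rw [← Set.inter_eq_right.2 hsub, ← Set.inter_assoc, hST, Set.inter_assoc]

/-- Every patch-open set contains, with a point `Y`, all points with the same patch as `Y` of
some radius. -/
theorem Transversal.exists_patch_subset_of_isOpen {d : ℕ} {X : Set (Ee d)}
    {U : Set (Transversal X)} (hU : IsOpen U) {Y : Transversal X} (hY : Y ∈ U) :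
    ∃ ρ : ℝ, 0 < ρ ∧ ∀ Z : Transversal X,
      Z.1 ∩ Metric.closedBall 0 ρ = Y.1 ∩ Metric.closedBall 0 ρ → Z ∈ U := by
  induction hU with
  | basic U hU =>
    obtain ⟨ρ, hρ, P, rfl⟩ := hU
    exact ⟨ρ, hρ, fun Z hZ => hZ.trans hY⟩
  | univ => exact ⟨1, one_pos, fun _ _ => trivial⟩
  | inter U V _ _ ihU ihV =>
    obtain ⟨ρ, hρ, h⟩ := ihU hY.1
    obtain ⟨σ, -, h'⟩ := ihV hY.2
    exact ⟨max ρ σ, lt_max_of_lt_left hρ, fun Z hZ =>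
      ⟨h Z (inter_closedBall_eq_of_le (le_max_left _ _) hZ),
        h' Z (inter_closedBall_eq_of_le (le_max_right _ _) hZ)⟩⟩
  | sUnion 𝒰 _ ih =>
    obtain ⟨U, hU, hYU⟩ := hY
    obtain ⟨ρ, hρ, h⟩ := ih U hU hYU
    exact ⟨ρ, hρ, fun Z hZ => ⟨U, hU, h Z hZ⟩⟩

theorem Transversal.exists_mem_patch_eq {d : ℕ} {X : Set (Ee d)} (Y : Transversal X) {ρ : ℝ}
    (hρ : 0 < ρ) :
    ∃ x ∈ X, setTranslate X x ∩ Metric.closedBall 0 ρ = Y.1 ∩ Metric.closedBall 0 ρ := by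
  obtain ⟨w, hw⟩ := Y.2.1 0 ρ hρ
  rw [setTranslate_zero] at hw
  have h0 : (0 : Ee d) ∈ setTranslate X w ∩ Metric.closedBall 0 ρ :=
    hw ▸ ⟨Y.2.2, Metric.mem_closedBall_self hρ.le⟩
  exact ⟨w, by simpa using mem_setTranslate.1 h0.1, hw.symm⟩

theorem IsRepetitive.exists_ne_patch_eq {d : ℕ} (hd : 1 ≤ d) {X : Set (Ee d)}
    (hrep : IsRepetitive X) {x : Ee d} (hx : x ∈ X) {ρ : ℝ} (hρ : 0 < ρ) :
    ∃ y ∈ X, y ≠ x ∧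
      setTranslate X y ∩ Metric.closedBall 0 ρ = setTranslate X x ∩ Metric.closedBall 0 ρ := by
  obtain ⟨L, hL, h⟩ := hrep ρ hρ
  have : Nonempty (Fin d) := ⟨⟨0, hd⟩⟩
  obtain ⟨v, hv⟩ := NormedSpace.exists_lt_norm ℝ (Ee d) L
  obtain ⟨y, hy, hyz, hP⟩ := h x hx (x + v)
  refine ⟨y, hy, ?_, hP⟩
  rintro rfl
  rw [dist_self_add_right] at hyz
  exact hv.not_ge hyz

/-- For a repetitive, strongly aperiodic `(r,R)`-Delone set `X` in `ℝ^d`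
of finite local complexity, the canonical transversal with the patch topology is nonempty
and perfect (it has no isolated point: every point lies in the closure of its
complement). -/
theorem transversal_nonempty_perfect
    (d : ℕ) (hd : 1 ≤ d) (r R : ℝ) (hr : 0 < r) (hR : 0 < R)
    (X : Set (Ee d)) (hX : IsDelone r R X) (hFLC : HasFLC X)
    (hrep : IsRepetitive X) (hap : IsStronglyAperiodic X) :
    Nonempty (Transversal X) ∧
      ∀ Y : Transversal X, Y ∈ closure ({Y}ᶜ : Set (Transversal X)) := by
  obtain ⟨x₀, hx₀, -⟩ := hX.2 0
  refine ⟨⟨Transversal.ofMem hx₀⟩, fun Y => mem_closure_iff.2 fun U hU hYU => ?_⟩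
  obtain ⟨ρ, hρ, hYρ⟩ := Transversal.exists_patch_subset_of_isOpen hU hYU
  obtain ⟨x, hx, hxY⟩ := Y.exists_mem_patch_eq hρ
  obtain ⟨y, hy, hyx, hP⟩ := hrep.exists_ne_patch_eq hd hx hρ
  by_cases hY : Transversal.ofMem hx = Y
  · refine ⟨Transversal.ofMem hy, hYρ _ (hP.trans hxY), fun hyY => hyx ?_⟩
    exact hap.setTranslate_injective (congrArg Subtype.val (hyY.trans hY.symm))
  · exact ⟨Transversal.ofMem hx, hYρ _ hxY, hY⟩
end
end
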